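/- Let p > 2 be real, ρ > 0, and λ ∈ ℝ. Suppose u : ℝ → ℝ is twice continuously differentiable, u(x) > 0 for all x ∈ ℝ, u''(x) + ρ·u(x)^(p−1) = λ·u(x) for all x ∈ ℝ, u(x) → 0 and u'(x) → 0 as x → ±∞, and u, u' are square-integrable on ℝ and u^p is integrable on ℝ. Then ∫_ℝ u'(x)² dx = ((p−2)/(2p))·ρ·∫_ℝ u(x)^p dx, and consequently (1/2)·∫_ℝ u'(x)² dx − (ρ/p)·∫_ℝ u(x)^p dx = ((p−6)/(4p))·ρ·∫_ℝ u(x)^p dx. -/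

import Mathlib

open Real Set MeasureTheory Filter

/-- The conserved energy of a solution of `u'' + ρ u^(p-1) = λ u` vanishes if `u` and `u'` tend
to zero at infinity. -/
theorem energy_eq_zero {p ρ lam : ℝ} (hp : 0 < p) {u u' u'' : ℝ → ℝ}
    (hu : ∀ x, HasDerivAt u (u' x) x) (hu' : ∀ x, HasDerivAt u' (u'' x) x)
    (hpos : ∀ x, 0 < u x)
    (heq : ∀ x, u'' x + ρ * u x ^ (p - 1) = lam * u x)
    (htop : Tendsto u atTop (nhds 0)) (htop' : Tendsto u' atTop (nhds 0)) (x : ℝ) :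
    u' x ^ 2 + 2 * ρ / p * u x ^ p - lam * u x ^ 2 = 0 := by
  let E : ℝ → ℝ := fun y => u' y ^ 2 + 2 * ρ / p * u y ^ p - lam * u y ^ 2
  have hE : ∀ y, HasDerivAt E 0 y := fun y => by
    have h := (((hu' y).pow 2).add
      (((hu y).rpow_const (p := p) (Or.inl (hpos y).ne')).const_mul (2 * ρ / p))).sub
      (((hu y).pow 2).const_mul lam)
    refine h.congr_deriv ?_
    have hy := heq y
    field_simp
    push_cast
    linear_combination 2 * u' y * hy
  have hconst : E = fun _ => E x := funext fun y =>
    is_const_of_deriv_eq_zero (fun z => (hE z).differentiableAt) (fun z => (hE z).deriv) y x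
  have hlim : Tendsto E atTop (nhds 0) := by
    have h := ((htop'.pow 2).add
      ((htop.rpow_const (p := p) (Or.inr hp.le)).const_mul (2 * ρ / p))).sub
      ((htop.pow 2).const_mul lam)
    simpa [Real.zero_rpow hp.ne'] using h
  rw [hconst] at hlim
  exact tendsto_nhds_unique tendsto_const_nhds hlim

/-- Testing `u'' + ρ u^(p-1) = λ u` with `u` itself. -/
theorem integral_deriv_sq_add_eq {p ρ lam : ℝ} {u u' u'' : ℝ → ℝ}
    (hu : ∀ x, HasDerivAt u (u' x) x) (hu' : ∀ x, HasDerivAt u' (u'' x) x)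
    (hpos : ∀ x, 0 < u x)
    (heq : ∀ x, u'' x + ρ * u x ^ (p - 1) = lam * u x)
    (htop : Tendsto u atTop (nhds 0)) (hbot : Tendsto u atBot (nhds 0))
    (htop' : Tendsto u' atTop (nhds 0)) (hbot' : Tendsto u' atBot (nhds 0))
    (hL2 : Integrable (fun x => u x ^ 2)) (hL2' : Integrable (fun x => u' x ^ 2))
    (hLp : Integrable (fun x => u x ^ p)) :
    (∫ x, u' x ^ 2) + lam * (∫ x, u x ^ 2) = ρ * ∫ x, u x ^ p := by
  have hderiv : ∀ x, HasDerivAt (fun y => u y * u' y)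
      (u' x ^ 2 + lam * u x ^ 2 - ρ * u x ^ p) x := fun x => by
    refine ((hu x).mul (hu' x)).congr_deriv ?_
    have hx : u x ^ p = u x ^ (p - 1) * u x := by
      rw [Real.rpow_sub_one (hpos x).ne', div_mul_cancel₀ _ (hpos x).ne']
    rw [hx]
    linear_combination u x * heq x
  have hsum : Integrable (fun x => u' x ^ 2 + lam * u x ^ 2) := hL2'.add (hL2.const_mul lam)
  have hint := integral_of_hasDerivAt_of_tendsto hderiv
    (hsum.sub (hLp.const_mul ρ)) (hbot.mul hbot') (htop.mul htop')
  rw [integral_sub hsum (hLp.const_mul ρ),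
    integral_add hL2' (hL2.const_mul lam), integral_const_mul, integral_const_mul] at hint
  linarith

/-- Pohozaev-type identity and energy identity for positive decaying solutions of
`u'' + ρ u^(p-1) = λ u` on `ℝ`:
`∫ u'² = ((p-2)/(2p)) ρ ∫ u^p`, hence `(1/2)∫u'² - (ρ/p)∫u^p = ((p-6)/(4p)) ρ ∫ u^p`. -/
theorem stmt_5 (p ρ lam : ℝ) (hp : 2 < p) (hρ : 0 < ρ)
    (u : ℝ → ℝ) (hu : ContDiff ℝ 2 u)
    (hpos : ∀ x, 0 < u x)
    (heq : ∀ x, deriv (deriv u) x + ρ * u x ^ (p - 1) = lam * u x)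
    (htop : Tendsto u atTop (nhds 0))
    (hbot : Tendsto u atBot (nhds 0))
    (htop' : Tendsto (deriv u) atTop (nhds 0))
    (hbot' : Tendsto (deriv u) atBot (nhds 0))
    (hL2 : Integrable (fun x => u x ^ 2))
    (hL2' : Integrable (fun x => deriv u x ^ 2))
    (hLp : Integrable (fun x => u x ^ p)) :
    (∫ x, deriv u x ^ 2) = (p - 2) / (2 * p) * ρ * ∫ x, u x ^ p ∧
    1 / 2 * (∫ x, deriv u x ^ 2) - ρ / p * (∫ x, u x ^ p)
      = (p - 6) / (4 * p) * ρ * ∫ x, u x ^ p := by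
  have hu1 : ∀ x, HasDerivAt u (deriv u x) x := fun x =>
    (hu.differentiable two_ne_zero x).hasDerivAt
  have hu2 : ∀ x, HasDerivAt (deriv u) (deriv (deriv u) x) x := fun x =>
    (hu.differentiable_deriv_two x).hasDerivAt
  have hp0 : 0 < p := by linarith
  have htest := integral_deriv_sq_add_eq hu1 hu2 hpos heq htop hbot htop' hbot' hL2 hL2' hLp
  have henergy : (∫ x, deriv u x ^ 2) + 2 * ρ / p * (∫ x, u x ^ p) - lam * (∫ x, u x ^ 2) = 0 := by
    have hsum : Integrable (fun x => deriv u x ^ 2 + 2 * ρ / p * u x ^ p) :=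
      hL2'.add (hLp.const_mul _)
    rw [← integral_const_mul, ← integral_const_mul, ← integral_add hL2' (hLp.const_mul _),
      ← integral_sub hsum (hL2.const_mul _)]
    simp only [energy_eq_zero hp0 hu1 hu2 hpos heq htop htop', integral_zero]
  have hmain : (∫ x, deriv u x ^ 2) = (p - 2) / (2 * p) * ρ * ∫ x, u x ^ p := by
    field_simp at henergy ⊢
    linear_combination henergy + p * htest
  refine ⟨hmain, ?_⟩
  rw [hmain]
  field_simp
  ring
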